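/- arXiv:1512.03719 — 2 statements merged into one kernel-verified Lean document; each statement's English description precedes it below -/
import Mathlib

section
/- For every positive definite matrix A with I ≤ A ≤ √2·I, there exists a positive definite matrix X with 0 ≤ X ≤ I such that A = X # (2I − X) + (I − X), where X # Y = X^{1/2}(X^{-1/2} Y X^{-1/2})^{1/2} X^{1/2} is the matrix geometric mean. -/
open scoped ComplexOrder

/-- Matrix absolute value via functional calculus: `|X| = (XᴴX)^{1/2}` for Hermitian `X`. -/
noncomputable def matAbs {𝕜 : Type*} [RCLike 𝕜] {m : Type*} [Fintype m] [DecidableEq m]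
    (X : Matrix m m 𝕜) : Matrix m m 𝕜 :=
  cfc (fun t : ℝ => |t|) X

/-- Matrix square root via functional calculus. -/
noncomputable def matSqrt {𝕜 : Type*} [RCLike 𝕜] {m : Type*} [Fintype m] [DecidableEq m]
    (X : Matrix m m 𝕜) : Matrix m m 𝕜 :=
  cfc Real.sqrt X

/-- Matrix geometric mean `A # B = A^{1/2} (A^{-1/2} B A^{-1/2})^{1/2} A^{1/2}`. -/
noncomputable def geomMean {𝕜 : Type*} [RCLike 𝕜] {m : Type*} [Fintype m] [DecidableEq m]
    (A B : Matrix m m 𝕜) : Matrix m m 𝕜 :=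
  matSqrt A * matSqrt ((matSqrt A)⁻¹ * B * (matSqrt A)⁻¹) * matSqrt A

/-- Loewner order: `A ≤ B` iff `B - A` is positive semidefinite. -/
def loewnerLE {𝕜 : Type*} [RCLike 𝕜] {m : Type*} [Fintype m] [DecidableEq m]
    (A B : Matrix m m 𝕜) : Prop :=
  (B - A).PosSemidef

namespace Matrix

variable {𝕜 m : Type*} [RCLike 𝕜] [Fintype m] [DecidableEq m]

lemma continuousOn_real_spectrum (A : Matrix m m 𝕜) (f : ℝ → ℝ) :
    ContinuousOn f (spectrum ℝ A) :=
  A.finite_real_spectrum.continuousOn f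

lemma IsHermitian.cfc_inv {A : Matrix m m 𝕜} (hA : A.IsHermitian) {f : ℝ → ℝ}
    (hf : ∀ x ∈ spectrum ℝ A, f x ≠ 0) :
    cfc (fun x => (f x)⁻¹) A = (cfc f A)⁻¹ := by
  rw [nonsing_inv_eq_ringInverse]
  exact _root_.cfc_inv f A hf (A.continuousOn_real_spectrum f) hA

lemma IsHermitian.matSqrt_cfc {A : Matrix m m 𝕜} (hA : A.IsHermitian) (f : ℝ → ℝ) :
    matSqrt (cfc f A) = cfc (fun x => √(f x)) A :=
  (cfc_comp' Real.sqrt f A Real.continuous_sqrt.continuousOn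
    (A.continuousOn_real_spectrum f) hA).symm

lemma IsHermitian.geomMean_cfc {A : Matrix m m 𝕜} (hA : A.IsHermitian) {f g : ℝ → ℝ}
    (hf : ∀ x ∈ spectrum ℝ A, 0 < f x) :
    geomMean (cfc f A) (cfc g A) = cfc (fun x => √(f x * g x)) A := by
  have hmul (u v : ℝ → ℝ) : cfc u A * cfc v A = cfc (fun x => u x * v x) A :=
    (cfc_mul u v A (A.continuousOn_real_spectrum u) (A.continuousOn_real_spectrum v)).symm
  rw [geomMean, hA.matSqrt_cfc f, ← hA.cfc_inv fun x hx => (Real.sqrt_pos.2 (hf x hx)).ne',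
    hmul, hmul, hA.matSqrt_cfc, hmul, hmul]
  refine cfc_congr fun x hx => ?_
  have hfx := hf x hx
  have hs : √(f x) * √(f x) = f x := Real.mul_self_sqrt hfx.le
  have hquot : (√(f x))⁻¹ * g x * (√(f x))⁻¹ = (f x)⁻¹ * g x := by
    rw [mul_right_comm, ← mul_inv, hs]
  have hprod : f x * g x = f x * f x * ((f x)⁻¹ * g x) := by field_simp
  rw [hquot, mul_right_comm, hs, hprod, Real.sqrt_mul (mul_self_nonneg _),
    Real.sqrt_mul_self hfx.le]

end Matrix

/-- The inverse of `t ↦ √(2t - t²) + 1 - t` as a map from `[1, √2]` to `(0, 1]`. -/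
noncomputable def geomMeanRepInv (a : ℝ) : ℝ := 1 - (a - √(2 - a ^ 2)) / 2

section

variable {a : ℝ}

lemma geomMeanRepInv_pos (h2 : a ≤ √2) : 0 < geomMeanRepInv a := by
  have hs := Real.sqrt_nonneg (2 - a ^ 2)
  have : √2 < 2 := by rw [Real.sqrt_lt' (by norm_num)]; norm_num
  unfold geomMeanRepInv
  linarith

lemma geomMeanRepInv_le_one (h1 : 1 ≤ a) : geomMeanRepInv a ≤ 1 := by
  have : √(2 - a ^ 2) ≤ 1 := Real.sqrt_le_one.2 (by nlinarith)
  unfold geomMeanRepInv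
  linarith

lemma sqrt_geomMeanRepInv (h1 : 1 ≤ a) (h2 : a ≤ √2) :
    √(geomMeanRepInv a * (2 - geomMeanRepInv a)) + (1 - geomMeanRepInv a) = a := by
  have ha : a ^ 2 ≤ 2 := (Real.le_sqrt (by linarith) (by norm_num)).1 h2
  have hs := Real.sqrt_nonneg (2 - a ^ 2)
  have hsq := Real.sq_sqrt (sub_nonneg.2 ha)
  have : geomMeanRepInv a * (2 - geomMeanRepInv a) = ((a + √(2 - a ^ 2)) / 2) ^ 2 := by
    unfold geomMeanRepInv
    linear_combination (-1 / 2) * hsq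
  rw [this, Real.sqrt_sq (by linarith)]
  unfold geomMeanRepInv
  ring

end

open scoped MatrixOrder in
theorem exists_X_geom_mean_rep {n : ℕ} (A : Matrix (Fin n) (Fin n) ℂ) (hA : A.PosDef)
    (h1 : loewnerLE 1 A) (h2 : loewnerLE A (((Real.sqrt 2 : ℝ) : ℂ) • 1)) :
    ∃ X : Matrix (Fin n) (Fin n) ℂ, X.PosDef ∧ X.PosSemidef ∧ loewnerLE X 1 ∧
      A = geomMean X (2 - X) + (1 - X) := by
  have hH : A.IsHermitian := hA.1
  have hself : IsSelfAdjoint A := hH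
  have hcont := A.continuousOn_real_spectrum
  have hlo : ∀ x ∈ spectrum ℝ A, 1 ≤ x := by
    refine (algebraMap_le_iff_le_spectrum (a := A) hself).1 ?_
    rw [map_one]
    exact h1
  have hhi : ∀ x ∈ spectrum ℝ A, x ≤ √2 := by
    refine (le_algebraMap_iff_spectrum_le (a := A) hself).1 ?_
    rw [Algebra.algebraMap_eq_smul_one]
    exact h2
  have hconst_sub (c : ℝ) : cfc (fun x => c - geomMeanRepInv x) A =
      algebraMap ℝ _ c - cfc geomMeanRepInv A := by
    rw [cfc_sub (fun _ => c) geomMeanRepInv A (hcont _) (hcont _), cfc_const c A hself]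
  have hone : cfc (fun x => 1 - geomMeanRepInv x) A = 1 - cfc geomMeanRepInv A := by
    rw [hconst_sub, map_one]
  have htwo : cfc (fun x => 2 - geomMeanRepInv x) A = 2 - cfc geomMeanRepInv A := by
    rw [hconst_sub, map_ofNat]
  have hX : (cfc geomMeanRepInv A).PosDef :=
    Matrix.isStrictlyPositive_iff_posDef.1 <|
      (cfc_isStrictlyPositive_iff geomMeanRepInv A (hcont _) hself).2
        fun x hx => geomMeanRepInv_pos (hhi x hx)
  refine ⟨cfc geomMeanRepInv A, hX, hX.posSemidef,
    cfc_le_one geomMeanRepInv A fun x hx => geomMeanRepInv_le_one (hlo x hx), ?_⟩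
  rw [← hone, ← htwo, hH.geomMean_cfc fun x hx => geomMeanRepInv_pos (hhi x hx),
    ← cfc_add A _ _ (hcont _) (hcont _)]
  conv_lhs => rw [← cfc_id ℝ A hself]
  exact cfc_congr fun x hx => (sqrt_geomMeanRepInv (hlo x hx) (hhi x hx)).symm
end

section
/- If A, B are positive definite matrices with A ≤ B ≤ √2·A, then there exist positive definite matrices X, Y such that A = (X+Y)/2 and B = X # Y + (1/2) X^{1/2} |I − X^{-1/2} Y X^{-1/2}| X^{1/2}. -/
open scoped ComplexOrder

open scoped MatrixOrder

lemma Matrix.PosSemidef.conj_posSemidef {m : Type*} [Fintype m] {X Y : Matrix m m ℂ}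
    (hY : Y.PosSemidef) (hX : X.PosSemidef) : (X * Y * X).PosSemidef := by
  simpa only [hX.isHermitian.eq] using hY.mul_mul_conjTranspose_same X

section MatSqrt

variable {m : Type*} [Fintype m] [DecidableEq m] {X Y G : Matrix m m ℂ}

lemma matSqrt_posSemidef (X : Matrix m m ℂ) : (matSqrt X).PosSemidef :=
  Matrix.nonneg_iff_posSemidef.mp (cfc_nonneg fun x _ => Real.sqrt_nonneg x)

lemma matSqrt_mul_self (hX : X.PosSemidef) : matSqrt X * matSqrt X = X := by
  have hsa : IsSelfAdjoint X := hX.isHermitian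
  have hpos := spectrum_nonneg_of_nonneg (𝕜 := ℝ) hX.nonneg
  rw [matSqrt, ← cfc_mul Real.sqrt Real.sqrt X]
  exact (cfc_congr fun x hx => Real.mul_self_sqrt (hpos hx)).trans (cfc_id' ℝ X)

lemma matSqrt_of_mul_self (hG : G.PosSemidef) : matSqrt (G * G) = G := by
  have hsa : IsSelfAdjoint G := hG.isHermitian
  have hpos := spectrum_nonneg_of_nonneg (𝕜 := ℝ) hG.nonneg
  have hsq : G * G = cfc (fun x : ℝ => x * x) G := by
    rw [cfc_mul (fun x : ℝ => x) (fun x : ℝ => x) G, cfc_id' ℝ G]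
  rw [matSqrt, hsq, ← cfc_comp' Real.sqrt (fun x : ℝ => x * x) G]
  exact (cfc_congr fun x hx => Real.sqrt_mul_self (hpos hx)).trans (cfc_id' ℝ G)

lemma matAbs_of_posSemidef (hX : X.PosSemidef) : matAbs X = X := by
  have hsa : IsSelfAdjoint X := hX.isHermitian
  have hpos := spectrum_nonneg_of_nonneg (𝕜 := ℝ) hX.nonneg
  exact (cfc_congr fun x hx => abs_of_nonneg (hpos hx)).trans (cfc_id' ℝ X)

lemma isUnit_det_matSqrt (hX : X.PosDef) : IsUnit (matSqrt X).det := by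
  have h := (Matrix.isUnit_iff_isUnit_det _).mp hX.isUnit
  rw [← matSqrt_mul_self hX.posSemidef, Matrix.det_mul] at h
  exact isUnit_of_mul_isUnit_left h

lemma matSqrt_inv_posSemidef (X : Matrix m m ℂ) : (matSqrt X)⁻¹.PosSemidef :=
  (matSqrt_posSemidef X).inv

lemma Matrix.PosDef.conj_matSqrt (hY : Y.PosDef) (hX : X.PosDef) :
    (matSqrt X * Y * matSqrt X).PosDef := by
  have hu := (Matrix.isUnit_iff_isUnit_det _).mpr (isUnit_det_matSqrt hX)
  have h := (Matrix.IsUnit.posDef_star_right_conjugate_iff (x := Y) hu).mpr hY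
  rwa [Matrix.star_eq_conjTranspose, (matSqrt_posSemidef X).isHermitian.eq] at h

/-- The geometric mean is the positive solution `G` of the Riccati equation `G X⁻¹ G = Y`. -/
lemma geomMean_eq_of_riccati (hX : X.PosDef) (hG : G.PosSemidef) (h : G * X⁻¹ * G = Y) :
    geomMean X Y = G := by
  have hu := isUnit_det_matSqrt hX
  have hinv : X⁻¹ = (matSqrt X)⁻¹ * (matSqrt X)⁻¹ := by
    rw [← Matrix.mul_inv_rev, matSqrt_mul_self hX.posSemidef]
  have hsq : (matSqrt X)⁻¹ * Y * (matSqrt X)⁻¹ =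
      ((matSqrt X)⁻¹ * G * (matSqrt X)⁻¹) * ((matSqrt X)⁻¹ * G * (matSqrt X)⁻¹) := by
    rw [← h, hinv]
    noncomm_ring
  rw [geomMean, hsq, matSqrt_of_mul_self (hG.conj_posSemidef (matSqrt_inv_posSemidef X)),
    Matrix.mul_assoc (matSqrt X)⁻¹, Matrix.mul_nonsing_inv_cancel_left _ _ hu,
    Matrix.nonsing_inv_mul_cancel_right _ _ hu]

lemma matSqrt_mul_matAbs_mul_matSqrt (hX : X.PosDef) (h : (X - Y).PosSemidef) :
    matSqrt X * matAbs (1 - (matSqrt X)⁻¹ * Y * (matSqrt X)⁻¹) * matSqrt X = X - Y := by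
  have hu := isUnit_det_matSqrt hX
  have hone : (matSqrt X)⁻¹ * X * (matSqrt X)⁻¹ = 1 := by
    nth_rw 2 [← matSqrt_mul_self hX.posSemidef]
    rw [Matrix.nonsing_inv_mul_cancel_left _ _ hu, Matrix.mul_nonsing_inv _ hu]
  have hsub : 1 - (matSqrt X)⁻¹ * Y * (matSqrt X)⁻¹ =
      (matSqrt X)⁻¹ * (X - Y) * (matSqrt X)⁻¹ := by
    rw [Matrix.mul_sub, Matrix.sub_mul, hone]
  rw [hsub, matAbs_of_posSemidef (h.conj_posSemidef (matSqrt_inv_posSemidef X)),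
    Matrix.mul_assoc (matSqrt X)⁻¹, Matrix.mul_nonsing_inv_cancel_left _ _ hu,
    Matrix.nonsing_inv_mul_cancel_right _ _ hu]

/-- The matrix version of writing `c ∈ [1, √2]` as `sin θ + cos θ` with `θ ∈ [0, π / 4]`. -/
lemma exists_sin_add_cos_rep {C : Matrix m m ℂ} (hC : IsSelfAdjoint C)
    (h1 : (C - 1).PosSemidef) (h2 : (((Real.sqrt 2 : ℝ) : ℂ) • (1 : Matrix m m ℂ) - C).PosSemidef) :
    ∃ S K : Matrix m m ℂ, S.PosSemidef ∧ K.PosSemidef ∧ (1 - S).PosDef ∧ S + K = C ∧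
      K * K = (1 - S) * (1 + S) ∧ K * S = S * K := by
  have hlow : ∀ x ∈ spectrum ℝ C, 1 ≤ x := (CFC.one_le_iff (R := ℝ) C).mp h1
  have hup : ∀ x ∈ spectrum ℝ C, x ≤ √2 := by
    refine (le_algebraMap_iff_spectrum_le (R := ℝ) (a := C)).mp ?_
    rw [Algebra.algebraMap_eq_smul_one, Matrix.le_iff]
    exact h2
  have hsq : ∀ x ∈ spectrum ℝ C, 0 ≤ 2 - x * x := fun x hx => by
    have := mul_self_le_mul_self (zero_le_one.trans (hlow x hx)) (hup x hx)
    rw [Real.mul_self_sqrt (by norm_num)] at this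
    linarith
  let s : ℝ → ℝ := fun x => (x - √(2 - x * x)) / 2
  let k : ℝ → ℝ := fun x => (x + √(2 - x * x)) / 2
  have hs : ContinuousOn s (spectrum ℝ C) := by fun_prop
  have hk : ContinuousOn k (spectrum ℝ C) := by fun_prop
  refine ⟨cfc s C, cfc k C, ?_, ?_, ?_, ?_, ?_, ?_⟩
  · refine Matrix.nonneg_iff_posSemidef.mp (cfc_nonneg fun x hx => ?_)
    have : √(2 - x * x) ≤ x :=
      Real.sqrt_le_iff.mpr ⟨by linarith [hlow x hx], by nlinarith [hlow x hx]⟩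
    simp only [s]
    linarith
  · refine Matrix.nonneg_iff_posSemidef.mp (cfc_nonneg fun x hx => ?_)
    have := Real.sqrt_nonneg (2 - x * x)
    simp only [k]
    linarith [hlow x hx]
  · have hle : cfc s C ≤ algebraMap ℝ _ (3 / 4) := by
      refine cfc_le_algebraMap s _ C fun x hx => ?_
      have := Real.sqrt_nonneg (2 - x * x)
      have h32 : √2 ≤ 3 / 2 := Real.sqrt_le_iff.mpr (by norm_num)
      simp only [s]
      linarith [hup x hx]
    have hpos : ((1 / 4 : ℝ) • (1 : Matrix m m ℂ)).PosDef := Matrix.PosDef.one.smul (by norm_num)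
    have := hpos.add_posSemidef (Matrix.le_iff.mp hle)
    rw [Algebra.algebraMap_eq_smul_one, ← add_sub_assoc, ← add_smul] at this
    norm_num at this
    exact this
  · rw [← cfc_add C s k]
    refine (cfc_congr fun x _ => ?_).trans (cfc_id' ℝ C)
    simp only [s, k]
    ring
  · have hsum : cfc k C * cfc k C + cfc s C * cfc s C = 1 := by
      rw [← cfc_mul k k C, ← cfc_mul s s C, ← cfc_add C (fun x => k x * k x) (fun x => s x * s x)]
      refine (cfc_congr fun x hx => ?_).trans (cfc_const_one ℝ C)
      simp only [s, k]
      linarith [Real.mul_self_sqrt (hsq x hx)]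
    rw [eq_sub_of_add_eq hsum]
    noncomm_ring
  · exact (cfc_commute_cfc k s C).eq

end MatSqrt

theorem exists_XY_reverse_rep {n : ℕ} (A B : Matrix (Fin n) (Fin n) ℂ)
    (hA : A.PosDef) (hB : B.PosDef)
    (h1 : loewnerLE A B) (h2 : loewnerLE B (((Real.sqrt 2 : ℝ) : ℂ) • A)) :
    ∃ X Y : Matrix (Fin n) (Fin n) ℂ, X.PosDef ∧ Y.PosDef ∧
      A = (1 / 2 : ℂ) • (X + Y) ∧
      B = geomMean X Y +
        (1 / 2 : ℂ) •
          (matSqrt X * matAbs (1 - (matSqrt X)⁻¹ * Y * (matSqrt X)⁻¹) * matSqrt X) := by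
  have hQ := matSqrt_posSemidef A
  have hu := isUnit_det_matSqrt hA
  have hQi := matSqrt_inv_posSemidef A
  have hQQ := matSqrt_mul_self hA.posSemidef
  set Q := matSqrt A
  have hone : Q⁻¹ * A * Q⁻¹ = 1 := by
    rw [← hQQ, Matrix.nonsing_inv_mul_cancel_left _ _ hu, Matrix.mul_nonsing_inv _ hu]
  have hC1 : (Q⁻¹ * B * Q⁻¹ - 1).PosSemidef := by
    have := Matrix.PosSemidef.conj_posSemidef h1 hQi
    rwa [Matrix.mul_sub, Matrix.sub_mul, hone] at this
  have hC2 : (((Real.sqrt 2 : ℝ) : ℂ) • (1 : Matrix (Fin n) (Fin n) ℂ) -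
      Q⁻¹ * B * Q⁻¹).PosSemidef := by
    have := Matrix.PosSemidef.conj_posSemidef h2 hQi
    rwa [Matrix.mul_sub, Matrix.sub_mul, Matrix.mul_smul, Matrix.smul_mul, hone] at this
  obtain ⟨S, K, hS, hK, hS1, hadd, hKK, hcomm⟩ :=
    exists_sin_add_cos_rep (hB.posSemidef.conj_posSemidef hQi).isHermitian hC1 hC2
  have hP : (1 + S).PosDef := Matrix.PosDef.one.add_posSemidef hS
  have hPu := (Matrix.isUnit_iff_isUnit_det _).mp hP.isUnit
  have hX : (Q * (1 + S) * Q).PosDef := hP.conj_matSqrt hA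
  have hdiff : Q * (1 + S) * Q - Q * (1 - S) * Q = (2 : ℂ) • (Q * S * Q) := by
    rw [two_smul]
    noncomm_ring
  have hKinv : K * (1 + S)⁻¹ * K = 1 - S := by
    have hPK : (1 + S) * K = K * (1 + S) := by
      rw [Matrix.add_mul, Matrix.mul_add, hcomm, Matrix.one_mul, Matrix.mul_one]
    have : (1 + S)⁻¹ * K = K * (1 + S)⁻¹ := by
      rw [← Matrix.mul_nonsing_inv_cancel_right _ ((1 + S)⁻¹ * K) hPu, Matrix.mul_assoc _ K,
        ← hPK, Matrix.nonsing_inv_mul_cancel_left _ _ hPu]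
    rw [Matrix.mul_assoc, this, ← Matrix.mul_assoc, hKK,
      Matrix.mul_nonsing_inv_cancel_right _ _ hPu]
  have hriccati : (Q * K * Q) * (Q * (1 + S) * Q)⁻¹ * (Q * K * Q) = Q * (1 - S) * Q := by
    rw [Matrix.mul_inv_rev, Matrix.mul_inv_rev, ← hKinv]
    simp only [Matrix.mul_assoc, Matrix.mul_nonsing_inv_cancel_left _ _ hu,
      Matrix.nonsing_inv_mul_cancel_left _ _ hu]
  refine ⟨Q * (1 + S) * Q, Q * (1 - S) * Q, hX, hS1.conj_matSqrt hA, ?_, ?_⟩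
  · have : Q * (1 + S) * Q + Q * (1 - S) * Q = (2 : ℂ) • A := by
      rw [two_smul, ← hQQ]
      noncomm_ring
    rw [this, smul_smul]
    norm_num
  · have hpsd : (Q * (1 + S) * Q - Q * (1 - S) * Q).PosSemidef := by
      rw [hdiff, two_smul]
      exact (hS.conj_posSemidef hQ).add (hS.conj_posSemidef hQ)
    rw [geomMean_eq_of_riccati hX (hK.conj_posSemidef hQ) hriccati,
      matSqrt_mul_matAbs_mul_matSqrt hX hpsd, hdiff, smul_smul]
    norm_num
    rw [← Matrix.add_mul, ← Matrix.mul_add, add_comm K S, hadd, Matrix.mul_assoc Q⁻¹,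
      Matrix.mul_nonsing_inv_cancel_left _ _ hu, Matrix.nonsing_inv_mul_cancel_right _ _ hu]
end
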